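/- arXiv:2411.07908 — 3 statements merged into one kernel-verified Lean document; each statement's English description precedes it below -/
import Mathlib

section
/- For all integers k ≥ 2 and t ≥ 2, every k-graph on (t−1)k vertices with matching number at most t−2 has at most C((t−1)k − 1, k) edges, and this bound is attained; that is, m((t−1)k, k, t−2) = C((t−1)k − 1, k), where C(a,b) denotes the binomial coefficient. -/
open Finset

variable {α : Type*} {β : Type*}

/-- An `r`-graph `H` is `t`-cancellative if for any subfamily `𝒜 ⊆ H` of at most `t` edges and
any two further distinct edges `B, C ∈ H` not in `𝒜`, the symmetric difference of `B` and `C`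
is not contained in the union of the edges of `𝒜`. -/
def IsCancellative [DecidableEq α] (t : ℕ) (H : Finset (Finset α)) : Prop :=
  ∀ 𝒜 ⊆ H, 𝒜.card ≤ t → ∀ B ∈ H, ∀ C ∈ H, B ∉ 𝒜 → C ∉ 𝒜 → B ≠ C →
    ¬((B \ C) ∪ (C \ B) ⊆ 𝒜.sup id)

/-- An `r`-graph `H` is `t`-union-free if any two distinct nonempty subfamilies of `H`, each
consisting of at most `t` edges, have distinct unions. -/
def IsUnionFree [DecidableEq α] (t : ℕ) (H : Finset (Finset α)) : Prop :=
  ∀ 𝒜 ⊆ H, ∀ ℬ ⊆ H, 𝒜.Nonempty → ℬ.Nonempty → 𝒜.card ≤ t → ℬ.card ≤ t → 𝒜 ≠ ℬ →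
    𝒜.sup id ≠ ℬ.sup id

/-- An `r`-graph `H` is `t`-cover-free if no edge of `H` is contained in the union of at most
`t` other edges of `H`. -/
def IsCoverFree [DecidableEq α] (t : ℕ) (H : Finset (Finset α)) : Prop :=
  ∀ 𝒜 ⊆ H, 𝒜.card ≤ t → ∀ B ∈ H, B ∉ 𝒜 → ¬(B ⊆ 𝒜.sup id)

/-- `H` is `(v, e)`-free if any `e` distinct edges of `H` have union of size at least `v + 1`. -/
def IsVEFree [DecidableEq α] (v e : ℕ) (H : Finset (Finset α)) : Prop :=
  ∀ 𝒜 ⊆ H, 𝒜.card = e → v + 1 ≤ (𝒜.sup id).card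

/-- The `k`-shadow of `F`: all `k`-subsets of the vertex set contained in some edge of `F`. -/
def kShadow [DecidableEq α] (k : ℕ) (F : Finset (Finset α)) : Finset (Finset α) :=
  F.sup fun A => Finset.powersetCard k A

/-- `J'` is a copy of `J`: the image of `J` under a map injective on the vertex set of `J`. -/
def IsCopyOf [DecidableEq α] [DecidableEq β] (J' : Finset (Finset β))
    (J : Finset (Finset α)) : Prop :=
  ∃ f : α → β, Set.InjOn f ↑(J.sup id) ∧ J' = J.image fun A => A.image f

/-- The matching number of `H` is at most `b`: every subfamily of pairwise disjoint edges
has at most `b` members. -/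
def MatchingNumberLE [DecidableEq α] (H : Finset (Finset α)) (b : ℕ) : Prop :=
  ∀ M ⊆ H, (∀ A ∈ M, ∀ B ∈ M, A ≠ B → Disjoint A B) → M.card ≤ b

/-- `C_t(n, r)`: the maximum number of edges in an `n`-vertex `t`-cancellative `r`-graph. -/
noncomputable def maxCancellative (t n r : ℕ) : ℕ :=
  sSup {N | ∃ H : Finset (Finset (Fin n)),
    (∀ e ∈ H, e.card = r) ∧ IsCancellative t H ∧ H.card = N}

/-- `U_t(n, r)`: the maximum number of edges in an `n`-vertex `t`-union-free `r`-graph. -/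
noncomputable def maxUnionFree (t n r : ℕ) : ℕ :=
  sSup {N | ∃ H : Finset (Finset (Fin n)),
    (∀ e ∈ H, e.card = r) ∧ IsUnionFree t H ∧ H.card = N}

/-- `F_t(n, r)`: the maximum number of edges in an `n`-vertex `t`-cover-free `r`-graph. -/
noncomputable def maxCoverFree (t n r : ℕ) : ℕ :=
  sSup {N | ∃ H : Finset (Finset (Fin n)),
    (∀ e ∈ H, e.card = r) ∧ IsCoverFree t H ∧ H.card = N}

/-- The number of permutations mapping a `k`-set into a family `F` of `k`-sets is the proportion
of `F` among all `k`-sets, times the number of permutations. -/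
theorem choose_mul_card_perm_map_mem [Fintype α] [DecidableEq α] {k : ℕ} {P : Finset α}
    (hP : P.card = k) {F : Finset (Finset α)} (hF : F ⊆ powersetCard k univ) :
    (Fintype.card α).choose k *
        (univ.filter fun σ : Equiv.Perm α => P.map σ.toEmbedding ∈ F).card =
      F.card * (Fintype.card α).factorial := by
  have fiber_card : ∀ A ∈ powersetCard k (univ : Finset α),
      (univ.filter fun σ : Equiv.Perm α => P.map σ.toEmbedding = A).card =
        (univ.filter fun σ : Equiv.Perm α => P.map σ.toEmbedding = P).card := by
    intro A hA
    obtain ⟨e⟩ : Nonempty (P ≃ A) := by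
      rw [← Fintype.card_eq]
      simp [hP, (mem_powersetCard.1 hA).2]
    let τ : Equiv.Perm α := e.extendSubtype
    have hτ : P.map τ.toEmbedding = A := by
      apply eq_of_subset_of_card_le
      · intro x hx
        obtain ⟨y, hy, rfl⟩ := mem_map.1 hx
        exact e.extendSubtype_mem y hy
      · simp [hP, (mem_powersetCard.1 hA).2]
    refine (card_equiv (Equiv.mulLeft τ) fun σ => ?_).symm
    have hmul : P.map (τ * σ).toEmbedding = (P.map σ.toEmbedding).map τ.toEmbedding := by
      rw [map_map]
      rfl
    simp only [mem_filter, mem_univ, true_and, Equiv.coe_mulLeft, hmul]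
    conv_rhs => rw [← hτ]
    exact (map_inj (f := τ.toEmbedding)).symm
  have card_maps : ∀ G ⊆ powersetCard k (univ : Finset α),
      (univ.filter fun σ : Equiv.Perm α => P.map σ.toEmbedding ∈ G).card =
        G.card * (univ.filter fun σ : Equiv.Perm α => P.map σ.toEmbedding = P).card := by
    intro G hG
    rw [card_eq_sum_card_fiberwise (f := fun σ : Equiv.Perm α => P.map σ.toEmbedding) (t := G)
      (fun σ hσ => by simpa using hσ)]
    rw [← smul_eq_mul, ← sum_const]
    refine sum_congr rfl fun A hA => ?_
    rw [← fiber_card A (hG hA), filter_filter]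
    congr 1
    ext σ
    simp only [mem_filter, mem_univ, true_and]
    exact ⟨fun h => h.2, fun h => ⟨h ▸ hA, h⟩⟩
  have total := card_maps _ Subset.rfl
  rw [filter_true_of_mem (fun σ _ => by simp [mem_powersetCard, hP]), card_univ,
    Fintype.card_perm, card_powersetCard, card_univ] at total
  rw [card_maps F hF, total]
  ring

/-- A `k`-graph on `s * k` vertices without a perfect matching has at most
`(s * k - 1).choose k` edges. -/
theorem card_le_choose_of_matchingNumberLE {s k : ℕ} (hs : 0 < s) (hk : 0 < k)
    {H : Finset (Finset (Fin (s * k)))} (hH : ∀ A ∈ H, A.card = k)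
    (hM : MatchingNumberLE H (s - 1)) : H.card ≤ (s * k - 1).choose k := by
  let block (j : Fin s) : Finset (Fin (s * k)) :=
    univ.map ((Function.Embedding.sectR j (Fin k)).trans finProdFinEquiv.toEmbedding)
  have block_card (j) : (block j).card = k := by simp [block]
  have block_disjoint : ∀ i j, i ≠ j → Disjoint (block i) (block j) := by
    intro i j hij
    rw [disjoint_left]
    intro x hi hj
    obtain ⟨a, -, rfl⟩ := mem_map.1 hi
    obtain ⟨b, -, hb⟩ := mem_map.1 hj
    exact hij (congrArg Prod.fst (finProdFinEquiv.injective hb)).symm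
  let F := powersetCard k univ \ H
  have hHsub : H ⊆ powersetCard k univ := fun A hA => by simp [mem_powersetCard, hH A hA]
  have exists_block (σ : Equiv.Perm (Fin (s * k))) :
      ∃ j, (block j).map σ.toEmbedding ∈ F := by
    by_contra! hcon
    have himage : ∀ j, (block j).map σ.toEmbedding ∈ H := fun j => by
      by_contra h
      exact hcon j (by simp [F, mem_powersetCard, block_card, h])
    have hdisj : ∀ i j, i ≠ j →
        Disjoint ((block i).map σ.toEmbedding) ((block j).map σ.toEmbedding) :=
      fun i j hij => (disjoint_map _).2 (block_disjoint i j hij)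
    have hinj : Function.Injective fun j => (block j).map σ.toEmbedding := by
      intro i j hij
      by_contra hne
      have h := hdisj i j hne
      rw [show (block i).map σ.toEmbedding = (block j).map σ.toEmbedding from hij,
        disjoint_self_iff_empty, map_eq_empty] at h
      have := block_card j
      rw [h, card_empty] at this
      omega
    have h := hM (univ.image fun j => (block j).map σ.toEmbedding)
      (by
        intro A hA
        obtain ⟨j, -, rfl⟩ := mem_image.1 hA
        exact himage j)
      (by
        intro A hA B hB hAB
        obtain ⟨i, -, rfl⟩ := mem_image.1 hA
        obtain ⟨j, -, rfl⟩ := mem_image.1 hB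
        exact hdisj i j fun hij => hAB (by rw [hij]))
    rw [card_image_of_injective _ hinj, card_univ, Fintype.card_fin] at h
    omega
  have perms_le : (s * k).factorial ≤
      ∑ j, (univ.filter fun σ : Equiv.Perm (Fin (s * k)) =>
        (block j).map σ.toEmbedding ∈ F).card := by
    calc (s * k).factorial = (univ : Finset (Equiv.Perm (Fin (s * k)))).card := by
          rw [card_univ, Fintype.card_perm, Fintype.card_fin]
      _ ≤ (univ.biUnion fun j => univ.filter fun σ : Equiv.Perm (Fin (s * k)) =>
            (block j).map σ.toEmbedding ∈ F).card :=
          card_le_card fun σ _ => by simpa using exists_block σ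
      _ ≤ _ := card_biUnion_le
  have choose_le : (s * k).choose k ≤ s * F.card := by
    refine Nat.le_of_mul_le_mul_right ?_ (Nat.factorial_pos (s * k))
    calc (s * k).choose k * (s * k).factorial
        ≤ (s * k).choose k * ∑ j, (univ.filter fun σ : Equiv.Perm (Fin (s * k)) =>
            (block j).map σ.toEmbedding ∈ F).card := Nat.mul_le_mul_left _ perms_le
      _ = ∑ _j : Fin s, F.card * (s * k).factorial := by
          rw [mul_sum]
          refine sum_congr rfl fun j _ => ?_
          simpa using choose_mul_card_perm_map_mem (block_card j) (F := F) sdiff_subset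
      _ = s * F.card * (s * k).factorial := by simp [mul_assoc]
  have hpos : 0 < s * k := Nat.mul_pos hs hk
  have absorb : (s * k).choose k = s * (s * k - 1).choose (k - 1) := by
    have h := Nat.add_one_mul_choose_eq (s * k - 1) (k - 1)
    rw [Nat.sub_add_cancel hpos, Nat.sub_add_cancel hk] at h
    refine Nat.eq_of_mul_eq_mul_right hk ?_
    rw [← h]
    ring
  have pascal : (s * k).choose k = (s * k - 1).choose (k - 1) + (s * k - 1).choose k := by
    have h := Nat.choose_succ_succ' (s * k - 1) (k - 1)
    rwa [Nat.sub_add_cancel hpos, Nat.sub_add_cancel hk] at h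
  have hF : (s * k - 1).choose (k - 1) ≤ F.card :=
    Nat.le_of_mul_le_mul_left (absorb ▸ choose_le) hs
  have hcard : F.card + H.card = (s * k).choose k := by
    rw [card_sdiff_add_card_eq_card hHsub, card_powersetCard, card_univ, Fintype.card_fin]
  omega

/-- A family of `k`-subsets of a set with fewer than `s * k` elements has no `s` pairwise disjoint
members. -/
theorem matchingNumberLE_powersetCard [DecidableEq α] {s k : ℕ} {S : Finset α}
    (hS : S.card < s * k) : MatchingNumberLE (powersetCard k S) (s - 1) := by
  intro M hM hdisj
  have hcard : (M.biUnion id).card = M.card * k := by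
    rw [card_biUnion (t := id) (fun A hA B hB hAB => hdisj A hA B hB hAB)]
    exact sum_const_nat fun A hA => (mem_powersetCard.1 (hM hA)).2
  have hle : (M.biUnion id).card ≤ S.card :=
    card_le_card (biUnion_subset.2 fun A hA => (mem_powersetCard.1 (hM hA)).1)
  have := Nat.lt_of_mul_lt_mul_right (hcard ▸ hle.trans_lt hS)
  omega

/-- `m((t-1)k, k, t-2) = C((t-1)k - 1, k)`: every `k`-graph on `(t-1)k` vertices with matching
number at most `t - 2` has at most `C((t-1)k - 1, k)` edges, and this bound is attained. -/
theorem erdos_matching_special_case (k t : ℕ) (hk : 2 ≤ k) (ht : 2 ≤ t) :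
    (∀ H : Finset (Finset (Fin ((t - 1) * k))), (∀ A ∈ H, A.card = k) →
      MatchingNumberLE H (t - 2) → H.card ≤ ((t - 1) * k - 1).choose k) ∧
    ∃ H : Finset (Finset (Fin ((t - 1) * k))), (∀ A ∈ H, A.card = k) ∧
      MatchingNumberLE H (t - 2) ∧ H.card = ((t - 1) * k - 1).choose k := by
  have hs : 0 < t - 1 := by omega
  have hk0 : 0 < k := by omega
  rw [show t - 2 = t - 1 - 1 by omega]
  refine ⟨fun H hH hM => card_le_choose_of_matchingNumberLE hs hk0 hH hM, ?_⟩
  have hpos : 0 < (t - 1) * k := Nat.mul_pos hs hk0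
  have hcard : ((univ : Finset (Fin ((t - 1) * k))).erase ⟨0, hpos⟩).card = (t - 1) * k - 1 := by
    simp [card_erase_of_mem]
  exact ⟨powersetCard k (univ.erase ⟨0, hpos⟩), fun A hA => (mem_powersetCard.1 hA).2,
    matchingNumberLE_powersetCard (by omega), by rw [card_powersetCard, hcard]⟩
end

section
/- Let t ≥ 2 and k ≥ 2 be integers. Let F be a (t+1)-union-free tk-graph with |V(F)| = m and k-shadow J(F), and let P = {(V(J_i), J_i) : i ∈ [|P|]} be an induced J(F)-packing in C([n], k). Suppose (i) F is (ℓ·tk − (ℓ−1)k − 1, ℓ)-free for all 2 ≤ ℓ ≤ 2t+2, and (ii) the m-graph V = {V(J_i) : i ∈ [|P|]} is (ℓm − (ℓ−1)k − 1, ℓ)-free for all 2 ≤ ℓ ≤ 2t+2. Then the tk-graph H(F) obtained by placing a copy F_i of F on top of each J_i and taking H(F) = ∪_i F_i is both t-cover-free and (t+1)-union-free. -/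
open Finset

variable {α : Type*} {β : Type*}

lemma sup_id_kShadow [DecidableEq α] {k : ℕ} {F : Finset (Finset α)} (hk : 1 ≤ k)
    (hF : ∀ A ∈ F, k ≤ A.card) : (kShadow k F).sup id = F.sup id := by
  apply le_antisymm
  · refine Finset.sup_le fun S hS => ?_
    obtain ⟨A, hA, hSA⟩ := Finset.mem_sup.mp hS
    exact (Finset.mem_powersetCard.mp hSA).1.trans (Finset.le_sup (f := id) hA)
  · refine Finset.sup_le fun A hA x hx => ?_
    obtain ⟨S, hxS, hSA, hS⟩ := Finset.exists_subsuperset_card_eq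
      (Finset.singleton_subset_iff.mpr hx) (by simpa using hk) (hF A hA)
    exact Finset.mem_sup.mpr ⟨S, Finset.mem_sup.mpr ⟨A, hA, Finset.mem_powersetCard.mpr ⟨hSA, hS⟩⟩,
      hxS (Finset.mem_singleton_self x)⟩

/-- Any `ℓ ≤ L` edges of `H` (with `ℓ ≥ 1`) span at least `ℓ r - (ℓ - 1) k` vertices. -/
def IsTreeSparse [DecidableEq α] (r k L : ℕ) (H : Finset (Finset α)) : Prop :=
  ∀ 𝒮 ⊆ H, 𝒮.Nonempty → 𝒮.card ≤ L → 𝒮.card * r + k ≤ (𝒮.sup id).card + 𝒮.card * k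

lemma isTreeSparse_of_isVEFree [DecidableEq α] {r k L : ℕ} {H : Finset (Finset α)}
    (hr : ∀ A ∈ H, A.card = r)
    (h : ∀ ℓ : ℕ, 2 ≤ ℓ → ℓ ≤ L → IsVEFree (ℓ * r - (ℓ - 1) * k - 1) ℓ H) :
    IsTreeSparse r k L H := by
  intro 𝒮 hs hne hL
  rcases Nat.lt_or_ge 𝒮.card 2 with h2 | h2
  · obtain ⟨A, rfl⟩ := Finset.card_eq_one.mp
      (show 𝒮.card = 1 by have := hne.card_pos; omega)
    have := hr A (hs (Finset.mem_singleton_self A))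
    simp [this]
  · have key := h 𝒮.card h2 hL 𝒮 hs rfl
    obtain ⟨s, hs'⟩ : ∃ s, 𝒮.card = s + 1 := ⟨𝒮.card - 1, by omega⟩
    rw [hs'] at key ⊢
    rw [Nat.add_sub_cancel] at key
    have e : (s + 1) * k = s * k + k := by ring
    omega

lemma sup_id_image_image [DecidableEq α] [DecidableEq β] (f : α → β) (S : Finset (Finset α)) :
    (S.image fun A => A.image f).sup id = (S.sup id).image f := by
  ext x
  simp only [Finset.mem_sup, Finset.mem_image, id]
  grind

lemma IsTreeSparse.image [DecidableEq α] [DecidableEq β] {r k L : ℕ} {H : Finset (Finset α)}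
    (hH : IsTreeSparse r k L H) {f : α → β} (hf : f.Injective) :
    IsTreeSparse r k L (H.image fun A => A.image f) := by
  intro 𝒮 hs hne hL
  obtain ⟨S, hS, rfl⟩ := Finset.subset_image_iff.mp hs
  rw [Finset.card_image_of_injective _ (Finset.image_injective hf)] at hL ⊢
  rw [sup_id_image_image, Finset.card_image_of_injective _ hf]
  exact hH S (by exact_mod_cast hS) (Finset.image_nonempty.mp hne) hL

lemma IsUnionFree.image [DecidableEq α] [DecidableEq β] {t : ℕ} {H : Finset (Finset α)}
    (hH : IsUnionFree t H) {f : α → β} (hf : f.Injective) :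
    IsUnionFree t (H.image fun A => A.image f) := by
  intro 𝒜 ha ℬ hb hane hbne hac hbc hne heq
  obtain ⟨S, hS, rfl⟩ := Finset.subset_image_iff.mp ha
  obtain ⟨T, hT, rfl⟩ := Finset.subset_image_iff.mp hb
  rw [Finset.card_image_of_injective _ (Finset.image_injective hf)] at hac hbc
  rw [sup_id_image_image, sup_id_image_image] at heq
  exact hH S (by exact_mod_cast hS) T (by exact_mod_cast hT) (Finset.image_nonempty.mp hane)
    (Finset.image_nonempty.mp hbne) hac hbc (fun h => hne (by rw [h]))
    (Finset.image_injective hf heq)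

/-- Passing from sets `V i` to subsets `W i` does not increase the overlap loss. -/
lemma card_sup_add_sum_le [DecidableEq α] {ι : Type*} [DecidableEq ι] (I : Finset ι)
    (V W : ι → Finset α) (hWV : ∀ i ∈ I, W i ⊆ V i) :
    (I.sup V).card + ∑ i ∈ I, (W i).card ≤ (I.sup W).card + ∑ i ∈ I, (V i).card := by
  induction I using Finset.induction_on with
  | empty => simp
  | insert a s ha ih =>
    have ih := ih fun i hi => hWV i (Finset.mem_insert_of_mem hi)
    rw [Finset.sup_insert, Finset.sup_insert, Finset.sum_insert ha, Finset.sum_insert ha]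
    have h1 := Finset.card_union_add_card_inter (V a) (s.sup V)
    have h2 := Finset.card_union_add_card_inter (W a) (s.sup W)
    have h3 : (W a ∩ s.sup W).card ≤ (V a ∩ s.sup V).card :=
      Finset.card_le_card (Finset.inter_subset_inter (hWV a (Finset.mem_insert_self a s))
        (Finset.sup_mono_fun fun i hi => hWV i (Finset.mem_insert_of_mem hi)))
    simp only [Finset.sup_eq_union]
    omega

/-- Placing sparse graphs on a sparse family of vertex sets gives a sparse graph. -/
lemma isTreeSparse_sup [DecidableEq α] {ι : Type*} [DecidableEq ι] [Fintype ι] {r k m L : ℕ}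
    (V : ι → Finset α) (Fs : ι → Finset (Finset α)) (hV : V.Injective)
    (hVs : IsTreeSparse m k L (Finset.univ.image V)) (hVm : ∀ i, (V i).card = m)
    (hFV : ∀ i, (Fs i).sup id ⊆ V i) (hFs : ∀ i, IsTreeSparse r k L (Fs i)) :
    IsTreeSparse r k L (Finset.univ.sup Fs) := by
  intro 𝒮 hs hne hL
  have hex : ∀ A ∈ 𝒮, ∃ i, A ∈ Fs i := fun A hA => by
    simpa [Finset.mem_sup] using hs hA
  obtain ⟨A₀, hA₀⟩ := hne
  obtain ⟨i₀, -⟩ := hex A₀ hA₀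
  have : ∀ A, ∃ i, A ∈ 𝒮 → A ∈ Fs i := fun A => by
    by_cases hA : A ∈ 𝒮
    · obtain ⟨i, hi⟩ := hex A hA
      exact ⟨i, fun _ => hi⟩
    · exact ⟨i₀, fun h => absurd h hA⟩
  choose b hb using this
  set I := 𝒮.image b
  set T : ι → Finset (Finset α) := fun i => 𝒮.filter fun A => b A = i
  have hTF : ∀ i, T i ⊆ Fs i := fun i A hA => by
    obtain ⟨h1, rfl⟩ := Finset.mem_filter.mp hA
    exact hb A h1
  have hTne : ∀ i ∈ I, (T i).Nonempty := fun i hi => by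
    obtain ⟨A, hA, rfl⟩ := Finset.mem_image.mp hi
    exact ⟨A, Finset.mem_filter.mpr ⟨hA, rfl⟩⟩
  have hTS : ∀ i, T i ⊆ 𝒮 := fun i => Finset.filter_subset _ _
  have hcard : 𝒮.card = ∑ i ∈ I, (T i).card :=
    Finset.card_eq_sum_card_fiberwise fun A hA => Finset.mem_image_of_mem b hA
  have hsup : (I.sup fun i => (T i).sup id) ⊆ 𝒮.sup id :=
    Finset.sup_le fun i _ => Finset.sup_mono (hTS i)
  have hloss := card_sup_add_sum_le I V (fun i => (T i).sup id) fun i _ =>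
    (Finset.sup_mono (hTF i)).trans (hFV i)
  have hblocks := hVs (I.image V) (Finset.image_subset_image (Finset.subset_univ I))
    (Finset.image_nonempty.mpr ⟨b A₀, Finset.mem_image_of_mem b hA₀⟩)
    (Finset.card_image_le.trans (Finset.card_image_le.trans hL))
  rw [Finset.card_image_of_injective _ hV, Finset.sup_image, Function.id_comp] at hblocks
  have hsum : ∑ i ∈ I, ((T i).card * r + k) ≤
      ∑ i ∈ I, (((T i).sup id).card + (T i).card * k) :=
    Finset.sum_le_sum fun i hi =>
      hFs i (T i) (hTF i) (hTne i hi) ((Finset.card_le_card (hTS i)).trans hL)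
  rw [Finset.sum_add_distrib, Finset.sum_add_distrib, ← Finset.sum_mul, ← Finset.sum_mul,
    ← hcard, Finset.sum_const, smul_eq_mul] at hsum
  have hVsum : ∑ i ∈ I, (V i).card = I.card * m := by
    rw [Finset.sum_congr rfl fun i _ => hVm i, Finset.sum_const, smul_eq_mul]
  have := Finset.card_le_card hsup
  omega

lemma card_le_sum_card_inter [DecidableEq α] {B : Finset α} {𝒜 : Finset (Finset α)}
    (h : B ⊆ 𝒜.sup id) : B.card ≤ ∑ A ∈ 𝒜, (B ∩ A).card := by
  refine (Finset.card_le_card fun x hx => ?_).trans Finset.card_biUnion_le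
  obtain ⟨A, hA, hxA⟩ := Finset.mem_sup.mp (h hx)
  exact Finset.mem_biUnion.mpr ⟨A, hA, Finset.mem_inter.mpr ⟨hx, hxA⟩⟩

lemma card_sup_id_le [DecidableEq α] {r : ℕ} {𝒜 : Finset (Finset α)}
    (h : ∀ A ∈ 𝒜, A.card = r) : (𝒜.sup id).card ≤ 𝒜.card * r := by
  rw [Finset.sup_eq_biUnion]
  exact Finset.card_biUnion_le_card_mul _ _ _ fun A hA => (h A hA).le

lemma IsTreeSparse.card_inter_le [DecidableEq α] {r k L : ℕ} {H : Finset (Finset α)}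
    (hH : IsTreeSparse r k L H) (hr : ∀ A ∈ H, A.card = r) (hL : 2 ≤ L) {A B : Finset α}
    (hA : A ∈ H) (hB : B ∈ H) (hAB : A ≠ B) : (A ∩ B).card ≤ k := by
  have h := hH {A, B} (by simp [Finset.insert_subset_iff, *]) (by simp) (by rwa [Finset.card_pair hAB])
  rw [Finset.card_pair hAB] at h
  have h1 := Finset.card_union_add_card_inter A B
  have h2 := hr A hA
  have h3 := hr B hB
  simp only [Finset.sup_insert, Finset.sup_singleton, id, Finset.sup_eq_union] at h
  omega

/-- Edges of `H` outside a block `Fs i` meet the vertex set of the block in fewer than `k`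
vertices, which makes coverings by `t` edges of a `tk`-edge live in a single block. -/
lemma isCoverFree_of_blocks [DecidableEq α] {ι : Type*} {t k L : ℕ} {H : Finset (Finset α)}
    {Fs : ι → Finset (Finset α)} (ht : 1 ≤ t) (hk : 1 ≤ k) (hL : 2 ≤ L)
    (hr : ∀ A ∈ H, A.card = t * k) (hH : IsTreeSparse (t * k) k L H)
    (hblock : ∀ A ∈ H, ∃ i, A ∈ Fs i) (hFs : ∀ i, IsUnionFree (t + 1) (Fs i))
    (hcross : ∀ i, ∀ A ∈ H, A ∉ Fs i → (A ∩ (Fs i).sup id).card < k) :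
    IsCoverFree t H := by
  intro 𝒜 ha hc B hB hBA hsub
  obtain ⟨i, hi⟩ := hblock B hB
  have hBV : B ⊆ (Fs i).sup id := Finset.le_sup (f := id) hi
  have hle : ∀ A ∈ 𝒜, (B ∩ A).card ≤ k := fun A hA =>
    hH.card_inter_le hr hL hB (ha hA) (by rintro rfl; exact hBA hA)
  have hcover := card_le_sum_card_inter hsub
  rw [hr B hB] at hcover
  have htk : 𝒜.card * k ≤ t * k := Nat.mul_le_mul_right k hc
  have hAF : 𝒜 ⊆ Fs i := by
    intro A hA
    by_contra hAi
    have hlt : (B ∩ A).card < k := by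
      refine lt_of_le_of_lt (Finset.card_le_card ?_) (hcross i A (ha hA) hAi)
      rw [Finset.inter_comm]
      exact Finset.inter_subset_inter_left hBV
    have := Finset.sum_lt_sum hle ⟨A, hA, hlt⟩
    rw [Finset.sum_const, smul_eq_mul] at this
    omega
  have hne : 𝒜.Nonempty := by
    rw [Finset.nonempty_iff_ne_empty]
    rintro rfl
    have := Nat.mul_pos ht hk
    simp at hcover
    omega
  refine hFs i 𝒜 hAF (insert B 𝒜) (Finset.insert_subset hi hAF) hne (Finset.insert_nonempty _ _)
    (by omega) ((Finset.card_insert_le _ _).trans (by omega))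
    (fun h => hBA (h ▸ Finset.mem_insert_self B 𝒜)) ?_
  rw [Finset.sup_insert]
  exact (sup_eq_right.mpr hsub).symm

/-- Two distinct `3`-families of `2k`-edges with two common edges and the same union
lie in a single block. -/
lemma isUnionFree_two_shared [DecidableEq α] {ι : Type*} {k L : ℕ} {H : Finset (Finset α)}
    {Fs : ι → Finset (Finset α)} (hL : 4 ≤ L)
    (hr : ∀ A ∈ H, A.card = 2 * k) (hH : IsTreeSparse (2 * k) k L H)
    (hblock : ∀ A ∈ H, ∃ i, A ∈ Fs i) (hFs : ∀ i, IsUnionFree 3 (Fs i))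
    (hcross : ∀ i, ∀ A ∈ H, A ∉ Fs i → (A ∩ (Fs i).sup id).card < k)
    {A B C D : Finset α} (hA : A ∈ H) (hB : B ∈ H) (hC : C ∈ H) (hD : D ∈ H)
    (hAB : A ≠ B) (hAC : A ≠ C) (hAD : A ≠ D) (hBC : B ≠ C) (hBD : B ≠ D) (hCD : C ≠ D) :
    A ∪ (C ∪ D) ≠ B ∪ (C ∪ D) := by
  intro heq
  have hx : (A ∩ B).card ≤ k := hH.card_inter_le hr (by omega) hA hB hAB
  have h4 := hH {A, B, C, D} (by simp [Finset.insert_subset_iff, *]) (by simp) (by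
    rw [show ({A, B, C, D} : Finset (Finset α)).card = 4 by grind]; omega)
  rw [show ({A, B, C, D} : Finset (Finset α)).card = 4 by grind] at h4
  simp only [Finset.sup_insert, Finset.sup_singleton, id, Finset.sup_eq_union] at h4
  have cA := hr A hA
  have cB := hr B hB
  have cC := hr C hC
  have cD := hr D hD
  have hunion : A ∪ (B ∪ (C ∪ D)) ⊆ (A ∩ B) ∪ (C ∪ D) := by
    intro x hx
    have := congrArg (x ∈ ·) heq
    simp only [Finset.mem_union, Finset.mem_inter] at this hx ⊢
    grind
  have hu := Finset.card_le_card hunion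
  have hu1 := Finset.card_union_le (A ∩ B) (C ∪ D)
  have hu2 := Finset.card_union_le C D
  have hxk : (A ∩ B).card = k := by omega
  have hABu := Finset.card_union_add_card_inter A B
  have three : ∀ X ∈ H, A ≠ X → B ≠ X → (X ∩ (A ∪ B)).card ≤ k := by
    intro X hX hAX hBX
    have h3 := hH {A, B, X} (by simp [Finset.insert_subset_iff, *]) (by simp) (by
      rw [show ({A, B, X} : Finset (Finset α)).card = 3 by grind]; omega)
    rw [show ({A, B, X} : Finset (Finset α)).card = 3 by grind] at h3
    simp only [Finset.sup_insert, Finset.sup_singleton, id, Finset.sup_eq_union] at h3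
    have e : A ∪ (B ∪ X) = X ∪ (A ∪ B) := by grind
    have := Finset.card_union_add_card_inter X (A ∪ B)
    have cX := hr X hX
    rw [e] at h3
    omega
  have hC' := three C hC hAC hBC
  have hD' := three D hD hAD hBD
  have hsd : A ∪ B ⊆ (A ∩ B) ∪ (C ∩ (A ∪ B) ∪ D ∩ (A ∪ B)) := by
    intro x hx
    have := congrArg (x ∈ ·) heq
    simp only [Finset.mem_union, Finset.mem_inter] at this hx ⊢
    grind
  have hs := Finset.card_le_card hsd
  have hs1 := Finset.card_union_le (A ∩ B) (C ∩ (A ∪ B) ∪ D ∩ (A ∪ B))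
  have hs2 := Finset.card_union_le (C ∩ (A ∪ B)) (D ∩ (A ∪ B))
  obtain ⟨i, hi⟩ := hblock A hA
  have inBlock : ∀ X ∈ H, ∀ Y ⊆ (Fs i).sup id, k ≤ (X ∩ Y).card → X ∈ Fs i := by
    intro X hX Y hY hXY
    by_contra hn
    have := hcross i X hX hn
    have := Finset.card_le_card (Finset.inter_subset_inter (subset_refl X) hY)
    omega
  have hAV : A ⊆ (Fs i).sup id := Finset.le_sup (f := id) hi
  have hBi : B ∈ Fs i := inBlock B hB A hAV (by rw [Finset.inter_comm]; omega)
  have hABV : A ∪ B ⊆ (Fs i).sup id :=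
    Finset.union_subset hAV (Finset.le_sup (f := id) hBi)
  have hCi : C ∈ Fs i := inBlock C hC _ hABV (by omega)
  have hDi : D ∈ Fs i := inBlock D hD _ hABV (by omega)
  refine hFs i {A, C, D} (by simp [Finset.insert_subset_iff, *]) {B, C, D} (by simp [Finset.insert_subset_iff, *])
    (by simp) (by simp)
    Finset.card_le_three Finset.card_le_three (fun h => ?_) ?_
  · have : A ∈ ({B, C, D} : Finset (Finset α)) := h ▸ Finset.mem_insert_self A _
    simp [hAB, hAC, hAD] at this
  · simpa only [Finset.sup_insert, Finset.sup_singleton, id, Finset.sup_eq_union] using heq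

/-- Distinct families of at most `t + 1` edges have distinct unions: sparsity of `H` rules out all
cases except `t = 2` with two common edges, where both families lie in one block. -/
lemma isUnionFree_of_blocks [DecidableEq α] {ι : Type*} {t k : ℕ} {H : Finset (Finset α)}
    {Fs : ι → Finset (Finset α)} (ht : 2 ≤ t) (hk : 1 ≤ k)
    (hr : ∀ A ∈ H, A.card = t * k) (hH : IsTreeSparse (t * k) k (2 * t + 2) H)
    (hblock : ∀ A ∈ H, ∃ i, A ∈ Fs i) (hFs : ∀ i, IsUnionFree (t + 1) (Fs i))
    (hcross : ∀ i, ∀ A ∈ H, A ∉ Fs i → (A ∩ (Fs i).sup id).card < k) :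
    IsUnionFree (t + 1) H := by
  have hcf : IsCoverFree t H :=
    isCoverFree_of_blocks (by omega) hk (by omega) hr hH hblock hFs hcross
  have full : ∀ 𝒜 ⊆ H, ∀ ℬ ⊆ H, 𝒜.card ≤ t + 1 → 𝒜.sup id = ℬ.sup id →
      ∀ B ∈ ℬ, B ∉ 𝒜 → 𝒜.card = t + 1 := by
    intro 𝒜 ha ℬ hb hac heq B hB hBA
    by_contra hn
    exact hcf 𝒜 ha (by omega) B (hb hB) hBA (heq ▸ Finset.le_sup (f := id) hB)
  intro 𝒜 ha ℬ hb _ _ hac hbc hne heq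
  have hcards : 𝒜.card = t + 1 ∧ ℬ.card = t + 1 := by
    by_cases h : ∃ B ∈ ℬ, B ∉ 𝒜
    · obtain ⟨B, hB, hBA⟩ := h
      have h1 := full 𝒜 ha ℬ hb hac heq B hB hBA
      refine ⟨h1, ?_⟩
      by_contra hn
      have : ¬ 𝒜 ⊆ ℬ := fun h => by
        have := Finset.card_le_card h
        omega
      obtain ⟨A, hA, hAB⟩ := Finset.not_subset.mp this
      exact hn (full ℬ hb 𝒜 ha hbc heq.symm A hA hAB)
    · push Not at h
      have hnot : ¬ 𝒜 ⊆ ℬ := fun h' => hne (h'.antisymm h)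
      obtain ⟨A, hA, hAB⟩ := Finset.not_subset.mp hnot
      have h1 := full ℬ hb 𝒜 ha hbc heq.symm A hA hAB
      exact ⟨by have := Finset.card_le_card (show ℬ ⊆ 𝒜 from h); omega, h1⟩
  obtain ⟨hac, hbc⟩ := hcards
  obtain ⟨q, hq⟩ : ∃ q, (𝒜 \ ℬ).card = q := ⟨_, rfl⟩
  have hq' : (ℬ \ 𝒜).card = q := by
    rw [← hq]; exact Finset.card_sdiff_comm (by omega)
  have hE : (𝒜 ∩ ℬ).card + q = t + 1 := by
    rw [← hq, ← hac]; exact Finset.card_inter_add_card_sdiff 𝒜 ℬ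
  have hun : (𝒜 ∪ ℬ).card = t + 1 + q := by
    have := Finset.card_union_add_card_inter 𝒜 ℬ
    omega
  have hq1 : 1 ≤ q := by
    by_contra h0
    have h0 : (𝒜 \ ℬ).card = 0 := by omega
    have hs := Finset.sdiff_eq_empty_iff_subset.mp (Finset.card_eq_zero.mp h0)
    exact hne (Finset.eq_of_subset_of_card_le hs (by omega))
  have hsp := hH (𝒜 ∪ ℬ) (Finset.union_subset ha hb)
    (Finset.card_pos.mp (by omega)) (by omega)
  rw [hun, Finset.sup_union, ← heq, sup_idem] at hsp
  have hub := card_sup_id_le fun A hA => hr A (ha hA)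
  rw [hac] at hub
  have hkey : (t + 1 + q) * (t * k) + k ≤ (t + 1) * (t * k) + (t + 1 + q) * k := by omega
  have hkey' : (t + 1 + q) * t + 1 ≤ (t + 1) * t + (t + 1 + q) := by
    refine Nat.le_of_mul_le_mul_right ?_ hk
    linarith
  have hqt : q * t ≤ t + q := by nlinarith
  rcases Nat.lt_or_ge q 2 with hq2 | hq2
  · obtain rfl : q = 1 := by omega
    obtain ⟨A, hA⟩ := Finset.card_eq_one.mp hq
    obtain ⟨B, hB⟩ := Finset.card_eq_one.mp hq'
    have hA' : A ∈ 𝒜 ∧ A ∉ ℬ := Finset.mem_sdiff.mp (hA ▸ Finset.mem_singleton_self A)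
    have hB' : B ∈ ℬ ∧ B ∉ 𝒜 := Finset.mem_sdiff.mp (hB ▸ Finset.mem_singleton_self B)
    have hAB : A ≠ B := fun h => hA'.2 (h ▸ hB'.1)
    have eA : 𝒜 = insert A (𝒜 ∩ ℬ) := by
      rw [Finset.insert_eq, ← hA, Finset.sdiff_union_inter]
    have eB : ℬ = insert B (𝒜 ∩ ℬ) := by
      rw [Finset.insert_eq, ← hB, Finset.inter_comm, Finset.sdiff_union_inter]
    have sA : 𝒜.sup id = A ∪ (𝒜 ∩ ℬ).sup id := by
      conv_lhs => rw [eA, Finset.sup_insert]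
      rfl
    have sB : ℬ.sup id = B ∪ (𝒜 ∩ ℬ).sup id := by
      conv_lhs => rw [eB, Finset.sup_insert]
      rfl
    rcases Nat.lt_or_ge t 3 with ht3 | ht3
    · obtain rfl : t = 2 := by omega
      obtain ⟨C, D, hCD, hEq⟩ := Finset.card_eq_two.mp (show (𝒜 ∩ ℬ).card = 2 by omega)
      have hC : C ∈ 𝒜 ∩ ℬ := by rw [hEq]; simp
      have hD : D ∈ 𝒜 ∩ ℬ := by rw [hEq]; simp
      rw [sA, sB, hEq, Finset.sup_insert, Finset.sup_singleton] at heq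
      have hC' := Finset.mem_inter.mp hC
      have hD' := Finset.mem_inter.mp hD
      exact isUnionFree_two_shared (by omega) hr hH hblock hFs hcross
        (ha hA'.1) (hb hB'.1) (ha hC'.1) (ha hD'.1) hAB
        (fun h => hA'.2 (h ▸ hC'.2)) (fun h => hA'.2 (h ▸ hD'.2))
        (fun h => hB'.2 (h ▸ hC'.1)) (fun h => hB'.2 (h ▸ hD'.1)) hCD heq
    · have hsub : 𝒜.sup id ⊆ (A ∩ B) ∪ (𝒜 ∩ ℬ).sup id := by
        intro x hx
        have hxB := heq ▸ hx
        rw [sA] at hx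
        rw [sB] at hxB
        grind
      have h1 := Finset.card_le_card hsub
      have h2 := Finset.card_union_le (A ∩ B) ((𝒜 ∩ ℬ).sup id)
      have h3 : (A ∩ B).card ≤ k :=
        hH.card_inter_le hr (by omega) (ha hA'.1) (hb hB'.1) hAB
      have h4 : ((𝒜 ∩ ℬ).sup id).card ≤ t * (t * k) := by
        have := card_sup_id_le (𝒜 := 𝒜 ∩ ℬ) fun A hA => hr A (ha (Finset.mem_inter.mp hA).1)
        rwa [show (𝒜 ∩ ℬ).card = t by omega] at this
      have h5 : (t + 1 + 1) * (t * k) ≤ t * (t * k) + (t + 2) * k := by linarith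
      have h6 : (t + 1 + 1) * t ≤ t * t + (t + 2) := by
        refine Nat.le_of_mul_le_mul_right ?_ hk
        linarith
      nlinarith
  · have hq3 : t = 2 ∧ q = 2 := by
      constructor <;> nlinarith
    obtain ⟨rfl, rfl⟩ := hq3
    obtain ⟨B, hB⟩ := Finset.card_pos.mp (show 0 < (ℬ \ 𝒜).card by omega)
    obtain ⟨hBb, hBa⟩ := Finset.mem_sdiff.mp hB
    obtain ⟨C, hC⟩ := Finset.card_eq_one.mp (show (𝒜 ∩ ℬ).card = 1 by omega)
    have hCE : C ∈ 𝒜 ∩ ℬ := hC ▸ Finset.mem_singleton_self C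
    obtain ⟨hCa, hCb⟩ := Finset.mem_inter.mp hCE
    have hBC : B ≠ C := fun h => hBa (h ▸ hCa)
    have hpair : {B, C} ⊆ ℬ := by simp [Finset.insert_subset_iff, hBb, hCb]
    have hdisj : ∀ x ∈ B, x ∉ C := by
      have h1 : ℬ.sup id = (B ∪ C) ∪ (ℬ \ {B, C}).sup id := by
        conv_lhs => rw [← Finset.union_sdiff_of_subset hpair]
        simp only [Finset.sup_union, Finset.sup_insert, Finset.sup_singleton, id,
          Finset.sup_eq_union]
      have h2 := card_sup_id_le (𝒜 := ℬ \ {B, C}) fun A hA =>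
        hr A (hb (Finset.mem_sdiff.mp hA).1)
      rw [Finset.card_sdiff_of_subset hpair, Finset.card_pair hBC, hbc] at h2
      have h3 := Finset.card_union_le (B ∪ C) ((ℬ \ {B, C}).sup id)
      have h4 := Finset.card_union_add_card_inter B C
      rw [← h1, ← heq] at h3
      have h5 := hr B (hb hBb)
      have h6 := hr C (hb hCb)
      have h7 : B ∩ C = ∅ := Finset.card_eq_zero.mp (by omega)
      intro x hxB hxC
      exact Finset.notMem_empty x (h7 ▸ Finset.mem_inter.mpr ⟨hxB, hxC⟩)
    refine hcf (𝒜 \ ℬ) (Finset.sdiff_subset.trans ha) (by omega) B (hb hBb)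
      (fun h => hBa (Finset.mem_sdiff.mp h).1) ?_
    intro x hx
    have hxU : x ∈ 𝒜.sup id := heq ▸ Finset.mem_sup.mpr ⟨B, hBb, hx⟩
    obtain ⟨A, hA, hxA⟩ := Finset.mem_sup.mp hxU
    refine Finset.mem_sup.mpr ⟨A, Finset.mem_sdiff.mpr ⟨hA, fun hAb => ?_⟩, hxA⟩
    have hAC : A ∈ 𝒜 ∩ ℬ := Finset.mem_inter.mpr ⟨hA, hAb⟩
    rw [hC, Finset.mem_singleton] at hAC
    exact hdisj x hx (hAC ▸ hxA)

/-- If `F` is a `(t+1)`-union-free `tk`-graph on `m` vertices which is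
`(ℓ·tk - (ℓ-1)k - 1, ℓ)`-free for all `2 ≤ ℓ ≤ 2t+2`, and `P` is an induced `J(F)`-packing
whose family of vertex sets is `(ℓm - (ℓ-1)k - 1, ℓ)`-free for all `2 ≤ ℓ ≤ 2t+2`, then
`H(F) = ∪ᵢ Fᵢ` is `t`-cover-free and `(t+1)`-union-free. -/
theorem HF_unionFree (t k m n : ℕ) (ht : 2 ≤ t) (hk : 2 ≤ k)
    (F : Finset (Finset (Fin m))) (hF : ∀ A ∈ F, A.card = t * k)
    (hFv : F.sup id = Finset.univ)
    (hFu : IsUnionFree (t + 1) F)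
    (N : ℕ) (Js : Fin N → Finset (Finset (Fin n)))
    (hcopy : ∀ i, IsCopyOf (Js i) (kShadow k F))
    (hdisj : ∀ i j, i ≠ j → Disjoint (Js i) (Js j))
    (hind : ∀ i j, i ≠ j →
      ((Js i).sup id ∩ (Js j).sup id).card ≤ k ∧
      (((Js i).sup id ∩ (Js j).sup id).card = k →
        (Js i).sup id ∩ (Js j).sup id ∉ Js i ∧
        (Js i).sup id ∩ (Js j).sup id ∉ Js j))
    (Fs : Fin N → Finset (Finset (Fin n)))
    (hFs : ∀ i, IsCopyOf (Fs i) F ∧ kShadow k (Fs i) = Js i)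
    (hFfree : ∀ ℓ : ℕ, 2 ≤ ℓ → ℓ ≤ 2 * t + 2 →
      IsVEFree (ℓ * (t * k) - (ℓ - 1) * k - 1) ℓ F)
    (hVfree : ∀ ℓ : ℕ, 2 ≤ ℓ → ℓ ≤ 2 * t + 2 →
      IsVEFree (ℓ * m - (ℓ - 1) * k - 1) ℓ
        (Finset.image (fun i => (Js i).sup id) Finset.univ)) :
    IsCoverFree t (Finset.univ.sup Fs) ∧
    IsUnionFree (t + 1) (Finset.univ.sup Fs) := by
  have hfs : ∀ i, ∃ f : Fin m → Fin n, f.Injective ∧ Fs i = F.image fun A => A.image f := by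
    intro i
    obtain ⟨f, hf, h⟩ := (hFs i).1
    rw [hFv, Finset.coe_univ, Set.injOn_univ] at hf
    exact ⟨f, hf, h⟩
  choose f hf hFf using hfs
  have hFsr : ∀ i, ∀ A ∈ Fs i, A.card = t * k := by
    intro i A hA
    rw [hFf i] at hA
    obtain ⟨A', hA', rfl⟩ := Finset.mem_image.mp hA
    rw [Finset.card_image_of_injective _ (hf i), hF A' hA']
  have hJV : ∀ i, (Js i).sup id = (Fs i).sup id := by
    intro i
    rw [← (hFs i).2]
    exact sup_id_kShadow (by omega) fun A hA => by
      rw [hFsr i A hA]; exact Nat.le_mul_of_pos_left k (by omega)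
  simp only [hJV] at hind hVfree
  have hVm : ∀ i, ((Fs i).sup id).card = m := by
    intro i
    rw [hFf i, sup_id_image_image, hFv, Finset.card_image_of_injective _ (hf i),
      Finset.card_univ, Fintype.card_fin]
  rcases F.eq_empty_or_nonempty with rfl | ⟨A₀, hA₀⟩
  · have hH : Finset.univ.sup Fs = ∅ := by
      rw [← Finset.bot_eq_empty, Finset.sup_eq_bot_iff]
      intro i _
      rw [hFf i, Finset.image_empty, Finset.bot_eq_empty]
    rw [hH]
    refine ⟨fun _ _ _ B hB => absurd hB (Finset.notMem_empty B), fun 𝒜 ha _ _ hne => ?_⟩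
    exact absurd (Finset.subset_empty.mp ha) hne.ne_empty
  have hkm : k < m := by
    have h1 := Finset.card_le_univ A₀
    rw [hF A₀ hA₀, Fintype.card_fin] at h1
    nlinarith
  have hVinj : (fun i => (Fs i).sup id).Injective := by
    intro i j hij
    by_contra hne
    have h1 := (hind i j hne).1
    rw [show (Fs j).sup id = (Fs i).sup id from hij.symm, Finset.inter_self, hVm i] at h1
    omega
  have hmem : ∀ A ∈ Finset.univ.sup Fs, ∃ i, A ∈ Fs i := fun A hA => by
    simpa [Finset.mem_sup] using hA
  have hr : ∀ A ∈ Finset.univ.sup Fs, A.card = t * k := fun A hA => by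
    obtain ⟨i, hi⟩ := hmem A hA
    exact hFsr i A hi
  have hFsparse := isTreeSparse_of_isVEFree hF hFfree
  have hVsparse : IsTreeSparse m k (2 * t + 2)
      (Finset.univ.image fun i => (Fs i).sup id) :=
    isTreeSparse_of_isVEFree (by
      intro V hV
      obtain ⟨i, -, rfl⟩ := Finset.mem_image.mp hV
      exact hVm i) hVfree
  have hH : IsTreeSparse (t * k) k (2 * t + 2) (Finset.univ.sup Fs) :=
    isTreeSparse_sup _ Fs hVinj hVsparse hVm (fun _ => subset_rfl) fun i => by
      rw [hFf i]; exact hFsparse.image (hf i)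
  have hUF : ∀ i, IsUnionFree (t + 1) (Fs i) := fun i => by
    rw [hFf i]; exact hFu.image (hf i)
  have hcross : ∀ i, ∀ A ∈ Finset.univ.sup Fs, A ∉ Fs i →
      (A ∩ (Fs i).sup id).card < k := by
    intro i A hA hAi
    obtain ⟨j, hj⟩ := hmem A hA
    have hji : j ≠ i := by rintro rfl; exact hAi hj
    obtain ⟨hle, hne⟩ := hind j i hji
    have hsub : A ∩ (Fs i).sup id ⊆ (Fs j).sup id ∩ (Fs i).sup id :=
      Finset.inter_subset_inter_right (Finset.le_sup (f := id) hj)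
    by_contra hge
    have heq := Finset.eq_of_subset_of_card_le hsub (by omega)
    have hcard : ((Fs j).sup id ∩ (Fs i).sup id).card = k := by
      have := congrArg Finset.card heq
      omega
    refine (hne hcard).1 ?_
    rw [← (hFs j).2, ← heq]
    exact Finset.mem_sup.mpr ⟨A, hj, Finset.mem_powersetCard.mpr
      ⟨Finset.inter_subset_left, heq ▸ hcard⟩⟩
  exact ⟨isCoverFree_of_blocks (by omega) (by omega) (by omega) hr hH hmem hUF hcross,
    isUnionFree_of_blocks ht (by omega) hr hH hmem hUF hcross⟩
end

section
/- Let t ≥ 2 and k ≥ 2 be integers. Let G = {G_1, …, G_N} be a (tk−1)-graph on a vertex set W that is (ℓ(tk−1) − (ℓ−1)k − 1, ℓ)-free for all 2 ≤ ℓ ≤ 2t+2, and let u_1, …, u_N be N distinct vertices disjoint from W. Then the tk-graph F = {G_i ∪ {u_i} : i ∈ [N]} is (t+1)-union-free and is (ℓ·tk − (ℓ−1)k − 1, ℓ)-free for all 2 ≤ ℓ ≤ 2t+2. -/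
open Finset

variable {α : Type*} {β : Type*}

section Pendant

variable {ι : Type*} [DecidableEq α] {W : Finset α} {G : ι → Finset α} {u : ι → α}

/-- A pendant vertex lies in the union of a family of pendant edges exactly when its own edge
belongs to the family. -/
theorem pendant_mem_sup_iff [Fintype ι] (hGW : ∀ i, G i ⊆ W) (hu : Function.Injective u)
    (huW : ∀ i, u i ∉ W) {𝒜 : Finset (Finset α)}
    (h𝒜 : 𝒜 ⊆ univ.image fun i => insert (u i) (G i)) (i : ι) :
    u i ∈ 𝒜.sup id ↔ insert (u i) (G i) ∈ 𝒜 := by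
  rw [mem_sup]
  constructor
  · rintro ⟨A, hA, hi⟩
    obtain ⟨j, -, rfl⟩ := mem_image.1 (h𝒜 hA)
    rcases mem_insert.1 hi with h | h
    · rwa [hu h]
    · exact absurd (hGW j h) (huW i)
  · exact fun h => ⟨_, h, mem_insert_self _ _⟩

/-- Attaching distinct new vertices to the edges makes all unions of subfamilies distinct. -/
theorem isUnionFree_pendant [Fintype ι] (hGW : ∀ i, G i ⊆ W) (hu : Function.Injective u)
    (huW : ∀ i, u i ∉ W) (t : ℕ) :
    IsUnionFree t (univ.image fun i => insert (u i) (G i)) := by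
  intro 𝒜 h𝒜 ℬ hℬ _ _ _ _ hne hsup
  have key (i : ι) : insert (u i) (G i) ∈ 𝒜 ↔ insert (u i) (G i) ∈ ℬ := by
    rw [← pendant_mem_sup_iff hGW hu huW h𝒜, ← pendant_mem_sup_iff hGW hu huW hℬ, hsup]
  refine hne (Subset.antisymm (fun A hA => ?_) fun A hA => ?_)
  · obtain ⟨i, -, rfl⟩ := mem_image.1 (h𝒜 hA)
    exact (key i).1 hA
  · obtain ⟨i, -, rfl⟩ := mem_image.1 (hℬ hA)
    exact (key i).2 hA

/-- Each pendant edge contributes exactly one new vertex to the union. -/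
theorem card_sup_pendant (hGW : ∀ i, G i ⊆ W) (hu : Function.Injective u)
    (huW : ∀ i, u i ∉ W) (s : Finset ι) :
    ((s.image fun i => insert (u i) (G i)).sup id).card =
      ((s.image G).sup id).card + s.card := by
  have hsup : (s.image fun i => insert (u i) (G i)).sup id = (s.image G).sup id ∪ s.image u := by
    ext x
    simp only [sup_image, Function.id_comp, mem_sup, mem_insert, mem_union, mem_image]
    grind
  have hdisj : Disjoint ((s.image G).sup id) (s.image u) := by
    rw [disjoint_left]
    simp only [sup_image, Function.id_comp, mem_sup, mem_image]
    rintro x ⟨i, -, hi⟩ ⟨j, -, rfl⟩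
    exact huW j (hGW i hi)
  rw [hsup, card_union_of_disjoint hdisj, card_image_of_injective _ hu]

/-- Attaching distinct new vertices to the edges raises the size of a union of `ℓ` edges
by `ℓ`. -/
theorem IsVEFree.pendant [Fintype ι] {v ℓ : ℕ} (hGW : ∀ i, G i ⊆ W)
    (hG : Function.Injective G) (hu : Function.Injective u) (huW : ∀ i, u i ∉ W)
    (h : IsVEFree v ℓ (univ.image G)) :
    IsVEFree (v + ℓ) ℓ (univ.image fun i => insert (u i) (G i)) := by
  intro 𝒜 h𝒜 hcard
  obtain ⟨s, -, rfl⟩ := subset_image_iff.1 h𝒜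
  have hinj : Function.Injective fun i => insert (u i) (G i) := by
    intro i j hij
    have hi : u i ∈ insert (u j) (G j) := hij.subset (mem_insert_self _ _)
    exact (mem_insert.1 hi).elim (fun h => hu h) fun h => absurd (hGW j h) (huW i)
  rw [card_image_of_injective _ hinj] at hcard
  have hs := h (s.image G) (image_subset_image (subset_univ s))
    ((card_image_of_injective _ hG).trans hcard)
  rw [card_sup_pendant hGW hu huW]
  omega

end Pendant

/-- If `G = {G_1, …, G_N}` is a `(tk-1)`-graph on `W` that is
`(ℓ(tk-1) - (ℓ-1)k - 1, ℓ)`-free for all `2 ≤ ℓ ≤ 2t+2`, and `u_1, …, u_N` are distinct new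
vertices, then the `tk`-graph `F = {G_i ∪ {u_i}}` is `(t+1)`-union-free and
`(ℓ·tk - (ℓ-1)k - 1, ℓ)`-free for all `2 ≤ ℓ ≤ 2t+2`. -/
theorem pendant_construction_unionFree {α : Type*} [DecidableEq α]
    (t k : ℕ) (ht : 2 ≤ t) (hk : 2 ≤ k)
    (W : Finset α) (N : ℕ) (G : Fin N → Finset α)
    (hGW : ∀ i, G i ⊆ W) (hGcard : ∀ i, (G i).card = t * k - 1)
    (hGinj : Function.Injective G)
    (hGfree : ∀ ℓ : ℕ, 2 ≤ ℓ → ℓ ≤ 2 * t + 2 →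
      IsVEFree (ℓ * (t * k - 1) - (ℓ - 1) * k - 1) ℓ (Finset.image G Finset.univ))
    (u : Fin N → α) (huinj : Function.Injective u) (huW : ∀ i, u i ∉ W) :
    IsUnionFree (t + 1)
      (Finset.image (fun i => insert (u i) (G i)) Finset.univ) ∧
    ∀ ℓ : ℕ, 2 ≤ ℓ → ℓ ≤ 2 * t + 2 →
      IsVEFree (ℓ * (t * k) - (ℓ - 1) * k - 1) ℓ
        (Finset.image (fun i => insert (u i) (G i)) Finset.univ) := by
  refine ⟨isUnionFree_pendant hGW huinj huW _, fun ℓ h₁ h₂ => ?_⟩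
  convert (hGfree ℓ h₁ h₂).pendant hGW hGinj huinj huW using 1
  have hlt : (ℓ - 1) * k + ℓ + 1 ≤ ℓ * (t * k) := by
    obtain ⟨m, rfl⟩ : ∃ m, ℓ = m + 1 := ⟨ℓ - 1, by omega⟩
    have htk : 2 * k ≤ t * k := Nat.mul_le_mul_right k ht
    simp only [Nat.add_sub_cancel]
    nlinarith [Nat.mul_le_mul_left (m + 1) htk, Nat.mul_le_mul_left m hk]
  rw [Nat.mul_sub, mul_one]
  omega
end
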